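/- arXiv:2308.15676 — 3 statements merged into one kernel-verified Lean document; each statement's English description precedes it below -/
import Mathlib

section
/- Let s, s' ≥ 0, C₁, C₂, C₁', C₂' > 0, and let h, h' : ℝ → ℂ be smooth functions such that for every n ∈ ℕ, sup_{x∈ℝ} |h^{(n)}(x)| ≤ C₁ C₂ⁿ n^{ns} and sup_{x∈ℝ} |h'^{(n)}(x)| ≤ C₁' C₂'ⁿ n^{ns'} (with the convention 0⁰ = 1). Then for every n ∈ ℕ, sup_{x∈ℝ} |(h·h')^{(n)}(x)| ≤ C₁C₁' (C₂+C₂')ⁿ n^{n·max(s,s')}; that is, the product of a Gevrey function of order s with constants (C₁,C₂) and a Gevrey function of order s' with constants (C₁',C₂') is a Gevrey function of order max(s,s') with constants (C₁C₁', C₂+C₂'). -/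
noncomputable section

/-- The Gevrey weight `k ^ (k * s)` is at most `n ^ (k * S)` when `k ≤ n` and `0 ≤ s ≤ S`. -/
theorem Real.natCast_rpow_mul_le_rpow_mul {k n : ℕ} (hkn : k ≤ n) {s S : ℝ} (hs : 0 ≤ s)
    (hsS : s ≤ S) : (k : ℝ) ^ ((k : ℝ) * s) ≤ (n : ℝ) ^ ((k : ℝ) * S) := by
  rcases Nat.eq_zero_or_pos k with rfl | hk
  · simp
  · have hn : (1 : ℝ) ≤ n := by exact_mod_cast hk.trans_le hkn
    calc (k : ℝ) ^ ((k : ℝ) * s) ≤ (n : ℝ) ^ ((k : ℝ) * s) := by gcongr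
      _ ≤ (n : ℝ) ^ ((k : ℝ) * S) := by gcongr

/-- **Product of Gevrey functions.** If `h ∈ G^s_{C₁,C₂}(ℝ)` and `h' ∈ G^{s'}_{C₁',C₂'}(ℝ)`
(with the convention `0⁰ = 1`, realized by `Real.rpow`), then
`h·h' ∈ G^{max(s,s')}_{C₁C₁', C₂+C₂'}(ℝ)`. -/
theorem gevrey_product
    (s s' : ℝ) (hs : 0 ≤ s) (hs' : 0 ≤ s')
    (C₁ C₂ C₁' C₂' : ℝ) (hC₁ : 0 < C₁) (hC₂ : 0 < C₂) (hC₁' : 0 < C₁') (hC₂' : 0 < C₂')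
    (h h' : ℝ → ℂ) (hsm : ContDiff ℝ (⊤ : ℕ∞) h) (hsm' : ContDiff ℝ (⊤ : ℕ∞) h')
    (hb : ∀ (n : ℕ) (x : ℝ), ‖iteratedDeriv n h x‖ ≤ C₁ * C₂ ^ n * (n : ℝ) ^ ((n : ℝ) * s))
    (hb' : ∀ (n : ℕ) (x : ℝ),
      ‖iteratedDeriv n h' x‖ ≤ C₁' * C₂' ^ n * (n : ℝ) ^ ((n : ℝ) * s')) :
    ∀ (n : ℕ) (x : ℝ),
      ‖iteratedDeriv n (fun y => h y * h' y) x‖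
        ≤ (C₁ * C₁') * (C₂ + C₂') ^ n * (n : ℝ) ^ ((n : ℝ) * max s s') := by
  intro n x
  have hmul : (fun y => h y * h' y) = h * h' := rfl
  have hS : 0 ≤ max s s' := hs.trans (le_max_left _ _)
  rw [hmul, iteratedDeriv_mul (hsm.contDiffAt.of_le (by exact_mod_cast le_top))
    (hsm'.contDiffAt.of_le (by exact_mod_cast le_top)), add_pow, Finset.mul_sum, Finset.sum_mul]
  refine norm_sum_le_of_le _ fun k hk => ?_
  have hkn : k ≤ n := Nat.lt_succ_iff.mp (Finset.mem_range.mp hk)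
  have hweight : (n : ℝ) ^ ((n : ℝ) * max s s') =
      (n : ℝ) ^ ((k : ℝ) * max s s') * (n : ℝ) ^ (((n - k : ℕ) : ℝ) * max s s') := by
    rw [← Real.rpow_add_of_nonneg (by positivity) (by positivity) (by positivity), ← add_mul,
      ← Nat.cast_add, Nat.add_sub_cancel' hkn]
  have hleft : ‖iteratedDeriv k h x‖ ≤ C₁ * C₂ ^ k * (n : ℝ) ^ ((k : ℝ) * max s s') :=
    (hb k x).trans <| by
      gcongr ?_ * ?_
      exact Real.natCast_rpow_mul_le_rpow_mul hkn hs (le_max_left _ _)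
  have hright : ‖iteratedDeriv (n - k) h' x‖ ≤
      C₁' * C₂' ^ (n - k) * (n : ℝ) ^ (((n - k : ℕ) : ℝ) * max s s') :=
    (hb' (n - k) x).trans <| by
      gcongr ?_ * ?_
      exact Real.natCast_rpow_mul_le_rpow_mul (Nat.sub_le n k) hs' (le_max_right _ _)
  rw [norm_mul, norm_mul, Complex.norm_natCast, hweight]
  calc (n.choose k : ℝ) * ‖iteratedDeriv k h x‖ * ‖iteratedDeriv (n - k) h' x‖
      ≤ (n.choose k : ℝ) * (C₁ * C₂ ^ k * (n : ℝ) ^ ((k : ℝ) * max s s')) *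
        (C₁' * C₂' ^ (n - k) * (n : ℝ) ^ (((n - k : ℕ) : ℝ) * max s s')) := by gcongr
    _ = _ := by ring
end
end

section
/- Let s ≥ 1, C₁, C₂ > 0, and let h : ℝ → ℂ be a smooth function supported in a compact measurable set Ω ⊂ ℝ of Lebesgue measure |Ω|, satisfying sup_{x∈ℝ} |h^{(n)}(x)| ≤ C₁ C₂ⁿ n^{ns} for every n ∈ ℕ (convention 0⁰ = 1). Define H(y) = (1/2π) ∫_ℝ h(x) e^{−ixy} dx. Then for every y ∈ ℝ: |H(y)| ≤ (C₁|Ω|/(2π)) · exp( es/2 − (s/(C₂^{1/s} e)) · |y|^{1/s} ), where e is Euler's number. -/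
open MeasureTheory

noncomputable section

open scoped FourierTransform

/-- The iterated derivatives of a function supported in a closed set are supported there. -/
lemma iteratedDeriv_eq_zero_of_notMem {h : ℝ → ℂ} {Ω : Set ℝ} (hΩ : IsClosed Ω)
    (hsupp : Function.support h ⊆ Ω) (n : ℕ) {x : ℝ} (hx : x ∉ Ω) :
    iteratedDeriv n h x = 0 := by
  have hx' : x ∉ Function.support (iteratedFDeriv ℝ n h) := fun hmem =>
    hx (closure_minimal hsupp hΩ (support_iteratedFDeriv_subset n hmem))
  rw [← norm_eq_zero, ← norm_iteratedFDeriv_eq_norm_iteratedDeriv, norm_eq_zero]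
  exact Function.notMem_support.mp hx'

/-- Repeated integration by parts bounds `|y| ^ n` times the Fourier integral of `h`
by a uniform bound on the `n`-th derivative times the measure of the support. -/
lemma abs_pow_mul_norm_fourier_integral_le {h : ℝ → ℂ} (hsm : ContDiff ℝ (⊤ : ℕ∞) h)
    {Ω : Set ℝ} (hΩ : IsCompact Ω) (hsupp : Function.support h ⊆ Ω) (n : ℕ) {B : ℝ}
    (hB : ∀ x, ‖iteratedDeriv n h x‖ ≤ B) (y : ℝ) :
    |y| ^ n * ‖∫ x : ℝ, h x * Complex.exp (-(Complex.I * x * y))‖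
      ≤ B * (volume Ω).toReal := by
  have hzero : ∀ k : ℕ, ∀ x ∉ Ω, iteratedDeriv k h x = 0 := fun k x hx =>
    iteratedDeriv_eq_zero_of_notMem hΩ.isClosed hsupp k hx
  have hint : ∀ k : ℕ, (k : ℕ∞) ≤ ⊤ → Integrable (iteratedDeriv k h) := fun k _ =>
    (hsm.continuous_iteratedDeriv k (by exact_mod_cast le_top)).integrable_of_hasCompactSupport
      (HasCompactSupport.intro hΩ (hzero k))
  have hpi : (Real.pi : ℂ) ≠ 0 := by exact_mod_cast Real.pi_ne_zero
  have htransform : 𝓕 h (y / (2 * Real.pi))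
      = ∫ x : ℝ, h x * Complex.exp (-(Complex.I * x * y)) := by
    rw [Real.fourier_real_eq_integral_exp_smul]
    refine integral_congr_ae (Filter.Eventually.of_forall fun x => ?_)
    simp only [smul_eq_mul]
    rw [mul_comm]
    congr 2
    push_cast
    field_simp
  have hderiv := congrFun (Real.fourier_iteratedDeriv (n := n) hsm hint le_top)
    (y / (2 * Real.pi))
  have hfactor : (2 * Real.pi * Complex.I * ((y / (2 * Real.pi) : ℝ) : ℂ)) = Complex.I * y := by
    push_cast
    field_simp
  rw [hfactor, htransform] at hderiv
  have hnorm := congrArg norm hderiv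
  rw [norm_smul, norm_pow, norm_mul, Complex.norm_I, one_mul, Complex.norm_real,
    Real.norm_eq_abs] at hnorm
  rw [← hnorm, Real.fourier_real_eq, ← setIntegral_eq_integral_of_forall_compl_eq_zero (s := Ω)
    fun x hx => by rw [hzero n x hx, smul_zero]]
  exact norm_setIntegral_le_of_norm_le_const hΩ.measure_lt_top fun x _ => by
    rw [Circle.norm_smul]
    exact hB x

/-- A quantitative optimization of `n ↦ (n / (e u)) ^ n` over the natural numbers. -/
lemma exists_nat_rpow_self_le {u : ℝ} (hu : 0 ≤ u) :
    ∃ n : ℕ, (u = 0 → n = 0) ∧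
      (n : ℝ) ^ (n : ℝ) ≤ (Real.exp 1 * u) ^ (n : ℝ) * Real.exp (Real.exp 1 / 2 - u) := by
  have he := Real.exp_one_gt_d9
  rcases le_total u (Real.exp 1 / 2) with hsmall | hlarge
  · refine ⟨0, fun _ => rfl, ?_⟩
    simpa using hsmall
  have hu1 : 1 ≤ u := by linarith
  have hu0 : 0 < u := by linarith
  refine ⟨⌊u⌋₊, fun h0 => absurd h0 hu0.ne', ?_⟩
  have hle : (⌊u⌋₊ : ℝ) ≤ u := Nat.floor_le hu
  have hlt : u < ⌊u⌋₊ + 1 := Nat.lt_floor_add_one u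
  have hn : (0 : ℝ) < ⌊u⌋₊ := by exact_mod_cast Nat.floor_pos.mpr hu1
  generalize (⌊u⌋₊ : ℝ) = m at hle hlt hn
  rw [Real.rpow_def_of_pos hn, Real.rpow_def_of_pos (by positivity), ← Real.exp_add,
    Real.exp_le_exp, Real.log_mul (Real.exp_ne_zero 1) hu0.ne', Real.log_exp]
  have hlog : Real.log m - Real.log u ≤ m / u - 1 := by
    rw [← Real.log_div hn.ne' hu0.ne']
    exact Real.log_le_sub_one_of_pos (by positivity)
  have hmul := mul_le_mul_of_nonneg_left hlog hn.le
  have hsq : m * (m / u - 1) - m + u = (m - u) ^ 2 / u := by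
    field_simp
    ring
  have hquot : (m - u) ^ 2 / u ≤ 1 := by
    rw [div_le_one hu0]
    nlinarith
  linarith

/-- **Fourier decay of compactly supported Gevrey functions.** If `h ∈ G^s_{C₁,C₂}(ℝ)` with
`s ≥ 1` is supported in a compact measurable set `Ω`, then its Fourier-type transform
`H(y) = (1/2π) ∫ h(x) e^{-ixy} dx` satisfies
`|H(y)| ≤ (C₁|Ω|/2π) exp(es/2 - (s/(C₂^{1/s} e)) |y|^{1/s})`. -/
theorem gevrey_fourier_decay
    (s : ℝ) (hs : 1 ≤ s) (C₁ C₂ : ℝ) (hC₁ : 0 < C₁) (hC₂ : 0 < C₂)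
    (h : ℝ → ℂ) (hsm : ContDiff ℝ (⊤ : ℕ∞) h)
    (Ω : Set ℝ) (hΩc : IsCompact Ω) (hΩm : MeasurableSet Ω)
    (hsupp : Function.support h ⊆ Ω)
    (hb : ∀ (n : ℕ) (x : ℝ), ‖iteratedDeriv n h x‖ ≤ C₁ * C₂ ^ n * (n : ℝ) ^ ((n : ℝ) * s)) :
    ∀ y : ℝ,
      ‖(1 / (2 * Real.pi) : ℝ) • ∫ x : ℝ, h x * Complex.exp (-(Complex.I * x * y))‖
        ≤ C₁ * (volume Ω).toReal / (2 * Real.pi) *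
            Real.exp (Real.exp 1 * s / 2 - s / (C₂ ^ (1 / s) * Real.exp 1) * |y| ^ (1 / s)) := by
  intro y
  have hs0 : 0 < s := by linarith
  set t : ℝ := (|y| / C₂) ^ (1 / s) with ht
  have ht0 : 0 ≤ t := by positivity
  have hts : t ^ s = |y| / C₂ := by
    rw [ht, ← Real.rpow_mul (by positivity), one_div_mul_cancel hs0.ne', Real.rpow_one]
  have hexponent : Real.exp 1 * s / 2 - s / (C₂ ^ (1 / s) * Real.exp 1) * |y| ^ (1 / s)
      = (Real.exp 1 / 2 - t / Real.exp 1) * s := by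
    rw [ht, Real.div_rpow (abs_nonneg y) hC₂.le]
    field_simp
  obtain ⟨n, hn0, hn⟩ := exists_nat_rpow_self_le (u := t / Real.exp 1) (by positivity)
  rw [mul_div_cancel₀ t (Real.exp_ne_zero 1)] at hn
  have hpow : (n : ℝ) ^ ((n : ℝ) * s)
      ≤ (|y| / C₂) ^ n * Real.exp ((Real.exp 1 / 2 - t / Real.exp 1) * s) := by
    calc (n : ℝ) ^ ((n : ℝ) * s) = ((n : ℝ) ^ (n : ℝ)) ^ s := Real.rpow_mul (by positivity) _ _
      _ ≤ (t ^ (n : ℝ) * Real.exp (Real.exp 1 / 2 - t / Real.exp 1)) ^ s :=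
        Real.rpow_le_rpow (by positivity) hn hs0.le
      _ = _ := by
        rw [Real.mul_rpow (by positivity) (by positivity), ← Real.exp_mul, ← Real.rpow_mul ht0,
          mul_comm (n : ℝ) s, Real.rpow_mul ht0, hts, Real.rpow_natCast]
  have hy : 0 < |y| ^ n := by
    rcases eq_or_ne y 0 with rfl | hy0
    · rw [hn0 (by simp [ht, Real.zero_rpow, hs0.ne']), pow_zero]
      exact one_pos
    · positivity
  have hdecay := abs_pow_mul_norm_fourier_integral_le hsm hΩc hsupp n (hb n) y
  have hbound : ‖∫ x : ℝ, h x * Complex.exp (-(Complex.I * x * y))‖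
      ≤ C₁ * (volume Ω).toReal * Real.exp ((Real.exp 1 / 2 - t / Real.exp 1) * s) := by
    refine le_of_mul_le_mul_left (hdecay.trans ?_) hy
    calc C₁ * C₂ ^ n * (n : ℝ) ^ ((n : ℝ) * s) * (volume Ω).toReal
        ≤ C₁ * C₂ ^ n * ((|y| / C₂) ^ n * Real.exp ((Real.exp 1 / 2 - t / Real.exp 1) * s))
          * (volume Ω).toReal := by gcongr
      _ = _ := by
        rw [div_pow]
        field_simp
  rw [hexponent, norm_smul, Real.norm_of_nonneg (by positivity)]
  calc _ ≤ 1 / (2 * Real.pi) * (C₁ * (volume Ω).toReal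
        * Real.exp ((Real.exp 1 / 2 - t / Real.exp 1) * s)) := by gcongr
    _ = _ := by ring
end
end

section
/- For every α > 1 and positive constants A₁ᵤ, A₂ᵤ, A₁ᵥ, A₂ᵥ there exist constants C₁f, C₂f > 0 (depending only on α, A₁ᵤ, A₂ᵤ, A₁ᵥ, A₂ᵥ) such that the following holds. Let S_ω > 2Δ > 0, let û : ℝ → ℝ be smooth with support contained in [−1,1] and sup|û^{(n)}| ≤ A₁ᵤ A₂ᵤⁿ n^{nα} for every n ∈ ℕ, and let v̂ : ℝ → ℝ be smooth with support contained in (−∞,0] and sup|v̂^{(n)}| ≤ A₁ᵥ A₂ᵥⁿ n^{nα} for every n ∈ ℕ (convention 0⁰ = 1). Define f̂(ω) = û(ω/S_ω)·v̂(ω/Δ) and f(s) = (1/2π)∫_ℝ f̂(ω)e^{−iωs}dω. Then for every s ∈ ℝ: |f(s)| ≤ C₁f · S_ω · exp( −C₂f · |sΔ|^{1/α} ). -/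
open MeasureTheory

noncomputable section

/-- Rescaling the argument by `c > 0` divides the geometric Gevrey constant by `c`. -/
theorem gevrey_bound_comp_div {α A B c : ℝ} (hc : 0 < c) {f : ℝ → ℝ}
    (hf : ContDiff ℝ (⊤ : ℕ∞) f)
    (hb : ∀ (n : ℕ) (x : ℝ), |iteratedDeriv n f x| ≤ A * B ^ n * (n : ℝ) ^ ((n : ℝ) * α))
    (n : ℕ) (x : ℝ) :
    |iteratedDeriv n (fun y => f (y / c)) x| ≤ A * (B / c) ^ n * (n : ℝ) ^ ((n : ℝ) * α) := by
  have hfn : ContDiff ℝ n f := hf.of_le (by exact_mod_cast le_top)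
  have h : iteratedDeriv n (fun y => f (y / c)) x = c⁻¹ ^ n * iteratedDeriv n f (c⁻¹ * x) := by
    simp_rw [div_eq_inv_mul]
    rw [iteratedDeriv_comp_const_mul hfn]
  rw [h, abs_mul, abs_of_pos (by positivity)]
  calc c⁻¹ ^ n * |iteratedDeriv n f (c⁻¹ * x)|
      ≤ c⁻¹ ^ n * (A * B ^ n * (n : ℝ) ^ ((n : ℝ) * α)) := by gcongr; exact hb n _
    _ = A * (B / c) ^ n * (n : ℝ) ^ ((n : ℝ) * α) := by
      rw [div_eq_mul_inv, mul_pow]; ring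

/-- Gevrey bounds are stable under products: the geometric constants add up. -/
theorem gevrey_bound_mul {α A₁ B₁ A₂ B₂ : ℝ} (hα : 0 ≤ α) (hA₁ : 0 ≤ A₁) (hB₁ : 0 ≤ B₁)
    (hA₂ : 0 ≤ A₂) (hB₂ : 0 ≤ B₂) {f g : ℝ → ℝ}
    (hf : ContDiff ℝ (⊤ : ℕ∞) f) (hg : ContDiff ℝ (⊤ : ℕ∞) g)
    (hfb : ∀ (n : ℕ) (x : ℝ), |iteratedDeriv n f x| ≤ A₁ * B₁ ^ n * (n : ℝ) ^ ((n : ℝ) * α))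
    (hgb : ∀ (n : ℕ) (x : ℝ), |iteratedDeriv n g x| ≤ A₂ * B₂ ^ n * (n : ℝ) ^ ((n : ℝ) * α))
    (n : ℕ) (x : ℝ) :
    |iteratedDeriv n (fun y => f y * g y) x|
      ≤ A₁ * A₂ * (B₁ + B₂) ^ n * (n : ℝ) ^ ((n : ℝ) * α) := by
  have h := norm_iteratedFDeriv_mul_le hf hg x (n := n) (by exact_mod_cast le_top)
  simp only [norm_iteratedFDeriv_eq_norm_iteratedDeriv, Real.norm_eq_abs] at h
  refine h.trans ?_
  rw [add_pow, Finset.mul_sum, Finset.sum_mul]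
  refine Finset.sum_le_sum fun i hi => ?_
  have hin : i ≤ n := Nat.lt_succ_iff.mp (Finset.mem_range.mp hi)
  have hsplit : (n : ℝ) ^ ((n : ℝ) * α)
      = (n : ℝ) ^ ((i : ℝ) * α) * (n : ℝ) ^ (((n - i : ℕ) : ℝ) * α) := by
    rw [← Real.rpow_add_of_nonneg (by positivity) (by positivity) (by positivity), ← add_mul,
      ← Nat.cast_add, Nat.add_sub_cancel' hin]
  have hpow : ∀ k ≤ n, (k : ℝ) ^ ((k : ℝ) * α) ≤ (n : ℝ) ^ ((k : ℝ) * α) := fun k hk =>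
    Real.rpow_le_rpow (by positivity) (by exact_mod_cast hk) (by positivity)
  calc (n.choose i : ℝ) * |iteratedDeriv i f x| * |iteratedDeriv (n - i) g x|
      ≤ (n.choose i : ℝ) * (A₁ * B₁ ^ i * (n : ℝ) ^ ((i : ℝ) * α))
          * (A₂ * B₂ ^ (n - i) * (n : ℝ) ^ (((n - i : ℕ) : ℝ) * α)) := by
        gcongr
        · exact (hfb i x).trans (by gcongr ?_ * ?_; exact hpow i hin)
        · exact (hgb (n - i) x).trans (by gcongr ?_ * ?_; exact hpow _ (Nat.sub_le n i))
    _ = A₁ * A₂ * (B₁ ^ i * B₂ ^ (n - i) * (n.choose i : ℝ)) * (n : ℝ) ^ ((n : ℝ) * α) := by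
        rw [hsplit]; ring

/-- The Fourier integral of a smooth function supported in `[-R, R]` decays polynomially, with a
constant controlled by the supremum of a derivative. -/
theorem pow_mul_norm_fourier_integral_le {g : ℝ → ℂ} {R M : ℝ} (hR : 0 ≤ R) {n : ℕ}
    (hg : ContDiff ℝ (⊤ : ℕ∞) g) (hsupp : Function.support g ⊆ Set.Icc (-R) R)
    (hM : ∀ x, ‖iteratedDeriv n g x‖ ≤ M) (s : ℝ) :
    |s| ^ n * ‖∫ ω : ℝ, g ω * Complex.exp (-(Complex.I * ω * s))‖ ≤ 2 * R * M := by
  have htsupp : tsupport g ⊆ Set.Icc (-R) R := closure_minimal hsupp isClosed_Icc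
  have hzero : ∀ k : ℕ, ∀ x ∉ Set.Icc (-R) R, iteratedDeriv k g x = 0 := fun k x hx => by
    have h : iteratedFDeriv ℝ k g x = 0 :=
      Function.notMem_support.mp fun h => hx (htsupp (support_iteratedFDeriv_subset k h))
    rw [← norm_eq_zero, ← norm_iteratedFDeriv_eq_norm_iteratedDeriv, h, norm_zero]
  have hint : ∀ k : ℕ, (k : ℕ∞) ≤ ⊤ → Integrable (iteratedDeriv k g) := fun k _ =>
    (hg.continuous_iteratedDeriv k (by exact_mod_cast le_top)).integrable_of_hasCompactSupport
      (HasCompactSupport.intro isCompact_Icc (hzero k))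
  have hfour := congrFun (Real.fourier_iteratedDeriv hg hint (n := n) le_top) (s / (2 * Real.pi))
  have hint_eq : FourierTransform.fourier g (s / (2 * Real.pi))
      = ∫ ω : ℝ, g ω * Complex.exp (-(Complex.I * ω * s)) := by
    rw [Real.fourier_real_eq_integral_exp_smul]
    congr 1 with ω
    rw [smul_eq_mul, mul_comm]
    congr 2
    have : (-2 * Real.pi * ω * (s / (2 * Real.pi)) : ℝ) = -(ω * s) := by
      field_simp
    rw [this]
    push_cast
    ring
  have hfactor : ‖(2 * Real.pi * Complex.I * ((s / (2 * Real.pi) : ℝ) : ℂ)) ^ n‖ = |s| ^ n := by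
    have : (2 * Real.pi * Complex.I * ((s / (2 * Real.pi) : ℝ) : ℂ)) = Complex.I * s := by
      have := Complex.ofReal_ne_zero.mpr Real.pi_ne_zero
      push_cast
      field_simp
    rw [this, norm_pow, norm_mul, Complex.norm_I, one_mul, Complex.norm_real, Real.norm_eq_abs]
  rw [← hint_eq, ← hfactor, ← norm_smul, ← hfour, Real.fourier_real_eq_integral_exp_smul,
    ← setIntegral_eq_integral_of_forall_compl_eq_zero (s := Set.Icc (-R) R)
      fun x hx => by rw [hzero n x hx, smul_zero]]
  refine (norm_setIntegral_le_of_norm_le_const (C := M) measure_Icc_lt_top fun x _ => ?_).trans_eq ?_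
  · rw [norm_smul, Complex.norm_exp_ofReal_mul_I, one_mul]
    exact hM x
  · rw [Real.volume_real_Icc_of_le (by linarith)]
    ring

/-- Optimising the order in Gevrey-type polynomial decay gives stretched exponential decay. -/
theorem le_exp_of_pow_mul_le {α B K t J : ℝ} (hα : 0 < α) (hB : 0 < B) (hK : 0 ≤ K)
    (ht : 0 ≤ t) (h : ∀ n : ℕ, t ^ n * J ≤ K * B ^ n * (n : ℝ) ^ ((n : ℝ) * α)) :
    J ≤ K * Real.exp 1 * Real.exp (-((Real.exp 1 * B) ^ (1 / α))⁻¹ * t ^ (1 / α)) := by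
  have he := Real.exp_pos 1
  set r : ℝ := (t / (Real.exp 1 * B)) ^ (1 / α) with hr
  have hr0 : 0 ≤ r := by positivity
  have hexponent : -((Real.exp 1 * B) ^ (1 / α))⁻¹ * t ^ (1 / α) = -r := by
    rw [hr, Real.div_rpow ht (by positivity), neg_mul, inv_mul_eq_div]
  obtain ⟨n, hn⟩ : ∃ n : ℕ, n = ⌊r⌋₊ := ⟨_, rfl⟩
  have hnr : (n : ℝ) ≤ r := hn ▸ Nat.floor_le hr0
  have hrn : r < n + 1 := hn ▸ Nat.lt_floor_add_one r
  have hJ : J ≤ K * Real.exp (-(n : ℝ)) := by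
    rcases Nat.eq_zero_or_pos n with h0 | hpos
    · have := h 0
      simp only [pow_zero, one_mul, mul_one, Nat.cast_zero, zero_mul, Real.rpow_zero] at this
      simpa [h0] using this
    · have hn0 : (0 : ℝ) < n := by exact_mod_cast hpos
      have hbase : (n : ℝ) ^ α ≤ t / (Real.exp 1 * B) := by
        calc (n : ℝ) ^ α ≤ r ^ α := Real.rpow_le_rpow hn0.le hnr hα.le
          _ = t / (Real.exp 1 * B) := by
            rw [hr, ← Real.rpow_mul (by positivity), one_div_mul_cancel hα.ne', Real.rpow_one]
      have ht0 : 0 < t := by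
        by_contra hcon
        have : t = 0 := le_antisymm (not_lt.mp hcon) ht
        rw [this, zero_div] at hbase
        exact absurd hbase (not_le.mpr (by positivity))
      have hpow : (n : ℝ) ^ ((n : ℝ) * α) = ((n : ℝ) ^ α) ^ n := by
        rw [mul_comm, Real.rpow_mul hn0.le, Real.rpow_natCast]
      refine le_of_mul_le_mul_left ?_ (pow_pos ht0 n)
      calc t ^ n * J ≤ K * B ^ n * ((n : ℝ) ^ α) ^ n := hpow ▸ h n
        _ ≤ K * B ^ n * (t / (Real.exp 1 * B)) ^ n := by gcongr
        _ = t ^ n * (K * Real.exp (-(n : ℝ))) := by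
          rw [div_pow, mul_pow, Real.exp_neg, ← Real.exp_one_pow]
          field_simp
  rw [hexponent, mul_assoc, ← Real.exp_add]
  exact hJ.trans (by gcongr; linarith)

/-- **Superpolynomial time-domain decay of the filter function.** For every Gevrey order
`α > 1` and Gevrey constants, there exist `C₁f, C₂f > 0` such that whenever
`f̂(ω) = û(ω/S_ω) v̂(ω/Δ)` with `û` Gevrey supported in `[-1,1]` and `v̂` Gevrey supported
in `(-∞,0]`, the inverse Fourier transform `f(s) = (1/2π)∫ f̂(ω)e^{-iωs}dω` satisfies
`|f(s)| ≤ C₁f S_ω exp(-C₂f |sΔ|^{1/α})`. -/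
theorem filter_function_time_decay (α : ℝ) (hα : 1 < α)
    (A1u A2u A1v A2v : ℝ)
    (hA1u : 0 < A1u) (hA2u : 0 < A2u) (hA1v : 0 < A1v) (hA2v : 0 < A2v) :
    ∃ C1f C2f : ℝ, 0 < C1f ∧ 0 < C2f ∧
      ∀ (Sω Δ : ℝ), 0 < Δ → 2 * Δ < Sω →
      ∀ (u v : ℝ → ℝ), ContDiff ℝ (⊤ : ℕ∞) u → ContDiff ℝ (⊤ : ℕ∞) v →
      Function.support u ⊆ Set.Icc (-1 : ℝ) 1 →
      Function.support v ⊆ Set.Iic (0 : ℝ) →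
      (∀ (n : ℕ) (x : ℝ), |iteratedDeriv n u x| ≤ A1u * A2u ^ n * (n : ℝ) ^ ((n : ℝ) * α)) →
      (∀ (n : ℕ) (x : ℝ), |iteratedDeriv n v x| ≤ A1v * A2v ^ n * (n : ℝ) ^ ((n : ℝ) * α)) →
      ∀ s : ℝ,
        ‖(1 / (2 * Real.pi) : ℝ) •
            ∫ ω : ℝ, ((u (ω / Sω) * v (ω / Δ) : ℝ) : ℂ) * Complex.exp (-(Complex.I * ω * s))‖
          ≤ C1f * Sω * Real.exp (-C2f * |s * Δ| ^ (1 / α)) := by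
  have hB : 0 < A2u + A2v := by positivity
  refine ⟨(1 / (2 * Real.pi)) * (2 * (A1u * A1v) * Real.exp 1),
    ((Real.exp 1 * (A2u + A2v)) ^ (1 / α))⁻¹, by positivity, by positivity, ?_⟩
  intro Sω Δ hΔ hS u v hu hv hus _ hub hvb s
  have hS0 : 0 < Sω := by linarith
  set G : ℝ → ℝ := fun ω => u (ω / Sω) * v (ω / Δ) with hG
  have hGsmooth : ContDiff ℝ (⊤ : ℕ∞) G :=
    (hu.comp (contDiff_id.div_const _)).mul (hv.comp (contDiff_id.div_const _))
  have hGbound : ∀ (n : ℕ) (x : ℝ), |iteratedDeriv n G x|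
      ≤ A1u * A1v * ((A2u + A2v) / Δ) ^ n * (n : ℝ) ^ ((n : ℝ) * α) := fun n x => by
    refine (gevrey_bound_mul (by linarith) hA1u.le (by positivity) hA1v.le (by positivity)
      (hu.comp (contDiff_id.div_const _)) (hv.comp (contDiff_id.div_const _))
      (gevrey_bound_comp_div hS0 hu hub) (gevrey_bound_comp_div hΔ hv hvb) n x).trans ?_
    rw [add_div]
    gcongr
    linarith
  have hGC : ContDiff ℝ (⊤ : ℕ∞) fun ω => (G ω : ℂ) := Complex.ofRealCLM.contDiff.comp hGsmooth
  have hGCbound : ∀ (n : ℕ) (x : ℝ), ‖iteratedDeriv n (fun ω => (G ω : ℂ)) x‖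
      ≤ A1u * A1v * ((A2u + A2v) / Δ) ^ n * (n : ℝ) ^ ((n : ℝ) * α) := fun n x => by
    have h := Complex.ofRealLI.norm_iteratedFDeriv_comp_left (hGsmooth.contDiffAt (x := x))
      (i := n) (by exact_mod_cast le_top)
    rw [norm_iteratedFDeriv_eq_norm_iteratedDeriv, norm_iteratedFDeriv_eq_norm_iteratedDeriv,
      Real.norm_eq_abs] at h
    exact h.trans_le (hGbound n x)
  have hGsupp : Function.support (fun ω => (G ω : ℂ)) ⊆ Set.Icc (-Sω) Sω := fun ω hω => by
    have hne : u (ω / Sω) ≠ 0 := fun h0 => hω (by simp [hG, h0])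
    have hmem := hus hne
    rwa [Set.mem_Icc, le_div_iff₀ hS0, div_le_iff₀ hS0, neg_one_mul, one_mul] at hmem
  have hdecay := le_exp_of_pow_mul_le (α := α) (B := A2u + A2v) (K := 2 * Sω * (A1u * A1v))
    (t := |s * Δ|) (J := ‖∫ ω : ℝ, (G ω : ℂ) * Complex.exp (-(Complex.I * ω * s))‖)
    (by linarith) hB (by positivity) (abs_nonneg _) fun n => by
      have h := pow_mul_norm_fourier_integral_le hS0.le hGC hGsupp (hGCbound n) s
      rw [abs_mul, abs_of_pos hΔ, mul_pow, mul_right_comm]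
      calc |s| ^ n * _ * Δ ^ n
          ≤ 2 * Sω * (A1u * A1v * ((A2u + A2v) / Δ) ^ n * (n : ℝ) ^ ((n : ℝ) * α)) * Δ ^ n := by
            gcongr
        _ = 2 * Sω * (A1u * A1v) * (A2u + A2v) ^ n * (n : ℝ) ^ ((n : ℝ) * α) := by
            rw [div_pow]; field_simp
  rw [norm_smul, Real.norm_of_nonneg (by positivity)]
  refine (mul_le_mul_of_nonneg_left hdecay (by positivity)).trans_eq ?_
  ring
end
end
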